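/- Consider the discrete crawler model where: (i) each mass is affected by dry friction with nonzero coefficients continuous in time, i.e. F_i(t,u) = {−μ_i⁺(t)} for u > 0, F_i(t,u) = {μ_i⁻(t)} for u < 0, and F_i(t,u) = [−μ_i⁺(t), μ_i⁻(t)] for u = 0, where the μ_i^± : ℝ → ℝ are continuous, T-periodic and positive; (ii) the shape functions z_i are continuously differentiable and T-periodic; (iii) the external load B is continuous, T-periodic and satisfies ∫₀ᵀ (B(s) − Σ_{i=1}^n μ_i⁺(s)) ds < 0 < ∫₀ᵀ (B(s) + Σ_{i=1}^n μ_i⁻(s)) ds. Then the inclusion v̇ ∈ G(t,v) admits exactly one T-periodic solution v*, which is a global attractor: every solution v on an interval [t₀, ∞) satisfies lim_{t→+∞} (v(t) − v*(t)) = 0. -/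

import Mathlib

open MeasureTheory Set Filter Topology
open scoped Classical

/-- Dry friction force with time-dependent coefficients `μp` (forward) and `μm` (backward):
`F(t,u) = {-μp t}` for `u > 0`, `{μm t}` for `u < 0`, `[-μp t, μm t]` for `u = 0`. -/
noncomputable def dryF (μp μm : ℝ → ℝ) (t u : ℝ) : Set ℝ :=
  if 0 < u then {-μp t} else if u < 0 then {μm t} else Set.Icc (-μp t) (μm t)

/-- The set-valued right-hand side of the discrete crawler dynamics:
`G(t,v) = (1/M)(B(t) + ∑ i, F_i(t, v + w_i(t)))`. -/
def crawlerG (n : ℕ) (M : ℝ) (B : ℝ → ℝ) (w : Fin n → ℝ → ℝ)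
    (F : Fin n → ℝ → ℝ → Set ℝ) (t v : ℝ) : Set ℝ :=
  {x | ∃ y : Fin n → ℝ, (∀ i, y i ∈ F i t (v + w i t)) ∧ x = (B t + ∑ i, y i) / M}

/-- `v` is a solution of the differential inclusion `v̇ ∈ G(t,v)` on the interval `I`:
`v` is locally absolutely continuous on `I` (primitive of a locally integrable `g`)
and its a.e. derivative `g` satisfies `g t ∈ G t (v t)` for a.e. `t ∈ I`. -/
def IsSolOn (G : ℝ → ℝ → Set ℝ) (v : ℝ → ℝ) (I : Set ℝ) : Prop :=
  ∃ g : ℝ → ℝ,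
    (∀ a ∈ I, ∀ b ∈ I, a ≤ b →
      IntervalIntegrable g volume a b ∧ v b - v a = ∫ s in a..b, g s) ∧
    (∀ᵐ t ∂(volume : Measure ℝ), t ∈ I → g t ∈ G t (v t))

open scoped NNReal
theorem false_of_periodic_drift {T t₀ C : ℝ} (hT : 0 < T) {d g h : ℝ → ℝ}
    (hd : ∀ a ∈ Ici t₀, ∀ b ∈ Ici t₀, a ≤ b →
      IntervalIntegrable g volume a b ∧ d b - d a = ∫ s in a..b, g s)
    (hgh : ∀ᵐ t ∂(volume : Measure ℝ), t ∈ Ici t₀ → g t ≤ h t)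
    (hcont : Continuous h) (hper : Function.Periodic h T) (hint : ∫ s in (0 : ℝ)..T, h s < 0)
    (hC : ∀ k : ℕ, C ≤ d (t₀ + k * T)) : False := by
  set I := ∫ s in (0 : ℝ)..T, h s with hI
  have hstep : ∀ k : ℕ, d (t₀ + k * T) ≤ d t₀ + k * I := by
    intro k
    have hle : t₀ ≤ t₀ + k * T := le_add_of_nonneg_right (by positivity)
    obtain ⟨hgi, hdi⟩ := hd t₀ self_mem_Ici (t₀ + k * T) hle hle
    have hmono : ∫ s in t₀..(t₀ + k * T), g s ≤ ∫ s in t₀..(t₀ + k * T), h s := by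
      refine intervalIntegral.integral_mono_ae_restrict hle hgi (hcont.intervalIntegrable _ _) ?_
      refine (ae_restrict_iff' measurableSet_Icc).2 ?_
      filter_upwards [hgh] with t ht hmem using ht hmem.1
    have hsum := hper.intervalIntegral_add_zsmul_eq k t₀ fun a b => hcont.intervalIntegrable a b
    rw [hper.intervalIntegral_add_eq t₀ 0, zero_add, ← hI] at hsum
    simp only [zsmul_eq_mul, Int.cast_natCast] at hsum
    linarith
  obtain ⟨k, hk⟩ := exists_nat_gt ((d t₀ - C) / (-I))
  have hneg : 0 < -I := by linarith
  rw [div_lt_iff₀ hneg] at hk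
  linarith [hstep k, hC k]

theorem dryF_le_of_lt {μp μm : ℝ → ℝ} {t a b x y : ℝ} (hμ : 0 < μp t ∧ 0 < μm t) (hba : b < a)
    (hx : x ∈ dryF μp μm t a) (hy : y ∈ dryF μp μm t b) : x ≤ y := by
  unfold dryF at hx hy
  split_ifs at hx hy <;> simp only [mem_singleton_iff, mem_Icc] at hx hy <;> grind

theorem dryF_sub_le_of_gap {μp μm : ℝ → ℝ} {t a b q c x y : ℝ} (hμ : 0 < μp t ∧ 0 < μm t)
    (hc : 0 < c) (hbq : b ≤ q) (hqa : q + c ≤ a)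
    (hx : x ∈ dryF μp μm t a) (hy : y ∈ dryF μp μm t b) :
    x - y ≤ -((μp t + μm t) * min 1 (max 0 (min (-q) (q + c)))) := by
  have hle := dryF_le_of_lt hμ (by linarith) hx hy
  rcases le_or_gt (min (-q) (q + c)) 0 with h | h
  · rw [max_eq_left h]
    simpa using hle
  · obtain ⟨h1, h2⟩ := lt_min_iff.1 h
    rw [dryF, if_pos (by linarith), mem_singleton_iff] at hx
    rw [dryF, if_neg (by linarith), if_pos (by linarith), mem_singleton_iff] at hy
    have : (μp t + μm t) * min 1 (max 0 (min (-q) (q + c))) ≤ (μp t + μm t) * 1 :=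
      mul_le_mul_of_nonneg_left (min_le_left _ _) (by linarith [hμ.1, hμ.2])
    rw [hx, hy]
    linarith

theorem crawlerG_le_of_lt {n : ℕ} {M : ℝ} (hM : 0 < M) {B : ℝ → ℝ} {w μp μm : Fin n → ℝ → ℝ}
    (hμ : ∀ i t, 0 < μp i t ∧ 0 < μm i t) {t a b x y : ℝ} (hba : b < a)
    (hx : x ∈ crawlerG n M B w (fun i => dryF (μp i) (μm i)) t a)
    (hy : y ∈ crawlerG n M B w (fun i => dryF (μp i) (μm i)) t b) : x ≤ y := by
  obtain ⟨f, hf, rfl⟩ := hx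
  obtain ⟨g, hg, rfl⟩ := hy
  have := Finset.sum_le_sum fun i (_ : i ∈ Finset.univ) =>
    dryF_le_of_lt (hμ i t) (add_lt_add_left hba (w i t)) (hf i) (hg i)
  gcongr

theorem IsSolOn.mono {G : ℝ → ℝ → Set ℝ} {v : ℝ → ℝ} {I J : Set ℝ} (h : IsSolOn G v I)
    (hJ : J ⊆ I) : IsSolOn G v J := by
  obtain ⟨g, hg, hG⟩ := h
  exact ⟨g, fun a ha b hb hab => hg a (hJ ha) b (hJ hb) hab,
    hG.mono fun t ht h => ht (hJ h)⟩

theorem IsSolOn.continuousOn_Ici {G : ℝ → ℝ → Set ℝ} {v : ℝ → ℝ} {t₀ : ℝ}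
    (h : IsSolOn G v (Ici t₀)) : ContinuousOn v (Ici t₀) := by
  obtain ⟨g, hg, -⟩ := h
  have key : ∀ b, t₀ ≤ b → ContinuousOn v (Icc t₀ b) := by
    intro b hb
    have hi := (hg t₀ self_mem_Ici b hb hb).1
    have hc := intervalIntegral.continuousOn_primitive_interval' hi left_mem_uIcc
    rw [uIcc_of_le hb] at hc
    refine ((continuousOn_const (c := v t₀)).add hc).congr fun t ht => ?_
    have := (hg t₀ self_mem_Ici t ht.1 ht.1).2
    simp only [Pi.add_apply]
    linarith
  intro t ht
  refine ((key (t + 1) (by linarith [mem_Ici.1 ht])) t ⟨ht, by linarith⟩).mono_of_mem_nhdsWithin ?_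
  rw [← Ici_inter_Iic]
  exact inter_mem_nhdsWithin _ (Iic_mem_nhds (by linarith))

theorem IsSolOn.sub_le_sub_of_pos {G : ℝ → ℝ → Set ℝ} {x y : ℝ → ℝ} {t₀ : ℝ}
    (hG : ∀ t p q f g, q < p → f ∈ G t p → g ∈ G t q → f ≤ g)
    (hx : IsSolOn G x (Ici t₀)) (hy : IsSolOn G y (Ici t₀)) {a b : ℝ} (ha : t₀ ≤ a) (hab : a ≤ b)
    (hb : y b < x b) : x b - y b ≤ x a - y a := by
  have hcont : ContinuousOn (fun t => x t - y t) (Icc a b) :=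
    (hx.continuousOn_Ici.sub hy.continuousOn_Ici).mono fun t ht => ha.trans ht.1
  obtain ⟨f, hf, hfG⟩ := hx
  obtain ⟨g, hg, hgG⟩ := hy
  have step : ∀ s ∈ Icc a b, (∀ t ∈ Ioo s b, y t < x t) → x b - y b ≤ x s - y s := by
    intro s hs hpos
    have hs0 : t₀ ≤ s := ha.trans hs.1
    obtain ⟨hfi, hfe⟩ := hf s hs0 b (hs0.trans hs.2) hs.2
    obtain ⟨hgi, hge⟩ := hg s hs0 b (hs0.trans hs.2) hs.2
    have : ∫ t in s..b, f t ≤ ∫ t in s..b, g t := by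
      refine intervalIntegral.integral_mono_ae_restrict hs.2 hfi hgi ?_
      rw [← restrict_Ioo_eq_restrict_Icc]
      refine (ae_restrict_iff' measurableSet_Ioo).2 ?_
      filter_upwards [hfG, hgG] with t htf htg ht
      have h0 : t ∈ Ici t₀ := hs0.trans ht.1.le
      exact hG t _ _ _ _ (hpos t ht) (htf h0) (htg h0)
    linarith
  set S := Icc a b ∩ (fun t => x t - y t) ⁻¹' Iic 0 with hS
  rcases S.eq_empty_or_nonempty with hE | hE
  · refine step a ⟨le_rfl, hab⟩ fun t ht => ?_
    by_contra hcon
    have : t ∈ S := ⟨Ioo_subset_Icc_self ht, by simpa using hcon⟩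
    simp [hE] at this
  · have hcl : IsClosed S := hcont.preimage_isClosed_of_isClosed isClosed_Icc isClosed_Iic
    have hbd : BddAbove S := ⟨b, fun t ht => ht.1.2⟩
    have hmem := hcl.csSup_mem hE hbd
    have hle := step (sSup S) hmem.1 fun t ht => by
      by_contra hcon
      have : t ∈ S := ⟨⟨hmem.1.1.trans ht.1.le, ht.2.le⟩, by simpa using hcon⟩
      exact absurd (le_csSup hbd this) (not_le.2 ht.1)
    have : x (sSup S) - y (sSup S) ≤ 0 := hmem.2
    linarith

theorem forall_nonneg_or_forall_add_nonpos {f : ℝ → ℝ} {c : ℝ} (hf : Continuous f) (hc : 0 < c)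
    (h : ∀ t, 0 ≤ f t ∨ f t + c ≤ 0) : (∀ t, 0 ≤ f t) ∨ ∀ t, f t + c ≤ 0 := by
  by_contra! ⟨⟨a, ha⟩, b, hb⟩
  have ha' := (h a).resolve_left (not_le.2 ha)
  obtain ⟨t, ht⟩ := mem_range_of_exists_le_of_exists_ge (c := -(c / 2)) hf ⟨a, by linarith⟩
    ⟨b, by linarith [(h b).resolve_right (not_le.2 hb)]⟩
  rcases h t with h | h <;> linarith

theorem crawler_false_of_separated {T : ℝ} (hT : 0 < T) {n : ℕ} {M : ℝ} (hM : 0 < M)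
    {μp μm : Fin n → ℝ → ℝ}
    (hμcont : ∀ i, Continuous (μp i) ∧ Continuous (μm i))
    (hμper : ∀ i, Function.Periodic (μp i) T ∧ Function.Periodic (μm i) T)
    (hμpos : ∀ i t, 0 < μp i t ∧ 0 < μm i t)
    {w : Fin n → ℝ → ℝ} (hwcont : ∀ i, Continuous (w i)) (hwper : ∀ i, Function.Periodic (w i) T)
    (hwint : ∀ i, ∫ s in (0 : ℝ)..T, w i s = 0)
    {B : ℝ → ℝ} (hBcont : Continuous B) (hBper : Function.Periodic B T)
    (hBp : ∫ s in (0 : ℝ)..T, (B s - ∑ i, μp i s) < 0)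
    (hBm : 0 < ∫ s in (0 : ℝ)..T, (B s + ∑ i, μm i s))
    {x y p : ℝ → ℝ} {t₀ c : ℝ} (hc : 0 < c) (hp : Continuous p) (hpper : Function.Periodic p T)
    (hx : IsSolOn (crawlerG n M B w fun i => dryF (μp i) (μm i)) x (Ici t₀))
    (hy : IsSolOn (crawlerG n M B w fun i => dryF (μp i) (μm i)) y (Ici t₀))
    (hyp : ∀ t, t₀ ≤ t → y t ≤ p t) (hpx : ∀ t, t₀ ≤ t → p t + c ≤ x t) : False := by
  obtain ⟨f, hf, hfG⟩ := hx
  obtain ⟨g, hg, hgG⟩ := hy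
  have hle : ∀ k : ℕ, t₀ ≤ t₀ + k * T := fun k => le_add_of_nonneg_right (by positivity)
  have hpk : ∀ k : ℕ, p (t₀ + k * T) = p t₀ := fun k => hpper.nat_mul k t₀
  have hgap : ∀ i t, 0 ≤ p t + w i t ∨ p t + w i t + c ≤ 0 := by
    intro i t₁
    by_contra! ⟨h1, h2⟩
    set h : ℝ → ℝ := fun t =>
      (μp i t + μm i t) * min 1 (max 0 (min (-(p t + w i t)) (p t + w i t + c))) / M with hh
    have hhc : Continuous h := by
      have := (hμcont i).1
      have := (hμcont i).2
      have := hwcont i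
      fun_prop
    have hhper : Function.Periodic h T := fun t => by
      simp only [hh, (hμper i).1 t, (hμper i).2 t, hpper t, hwper i t]
    have hh0 : ∀ t, 0 ≤ h t := fun t =>
      div_nonneg (mul_nonneg (add_pos (hμpos i t).1 (hμpos i t).2).le
        (le_min zero_le_one (le_max_left _ _))) hM.le
    have hh1 : 0 < h t₁ :=
      div_pos (mul_pos (add_pos (hμpos i t₁).1 (hμpos i t₁).2)
        (lt_min zero_lt_one (lt_max_of_lt_right (lt_min (by linarith) h2)))) hM
    have hpos : 0 < ∫ s in (0 : ℝ)..T, h s := by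
      have hshift := hhper.intervalIntegral_add_eq t₁ 0
      rw [zero_add] at hshift
      rw [← hshift]
      exact intervalIntegral.integral_pos (by linarith) hhc.continuousOn (fun t _ => hh0 t)
        ⟨t₁, ⟨le_rfl, by linarith⟩, hh1⟩
    refine false_of_periodic_drift (d := fun t => x t - y t) (g := fun t => f t - g t)
      (h := fun t => -h t) (t₀ := t₀) (C := c) hT ?_ ?_ hhc.neg (fun t => by simp [hhper t])
      (by simpa using hpos) fun k => by linarith [hyp _ (hle k), hpx _ (hle k)]
    · intro a ha b hb hab
      obtain ⟨hfi, hfe⟩ := hf a ha b hb hab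
      obtain ⟨hgi, hge⟩ := hg a ha b hb hab
      refine ⟨hfi.sub hgi, ?_⟩
      rw [intervalIntegral.integral_sub hfi hgi]
      linarith
    · filter_upwards [hfG, hgG] with t htf htg ht
      obtain ⟨u, hu, hfu⟩ := htf ht
      obtain ⟨v, hv, hgv⟩ := htg ht
      have hyt := hyp t ht
      have hxt := hpx t ht
      have hrest : ∑ j ∈ Finset.univ.erase i, (u j - v j) ≤ 0 :=
        Finset.sum_nonpos fun j _ => sub_nonpos.2 <|
          dryF_le_of_lt (hμpos j t) (by linarith) (hu j) (hv j)
      have hi := dryF_sub_le_of_gap (hμpos i t) (q := p t + w i t) hc (by linarith)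
        (by linarith) (hu i) (hv i)
      have hsum := Finset.add_sum_erase Finset.univ (fun j => u j - v j) (Finset.mem_univ i)
      simp only [Finset.sum_sub_distrib] at hsum hrest
      rw [hfu, hgv, hh, ← sub_div, ← neg_div]
      gcongr
      linarith
  have hsign : ∀ i, (∀ t, 0 ≤ p t + w i t) ∨ ∀ t, p t + w i t + c ≤ 0 := fun i =>
    forall_nonneg_or_forall_add_nonpos (hp.add (hwcont i)) hc (hgap i)
  have hint : ∀ i (a : ℝ), ∫ s in (0 : ℝ)..T, (p s + w i s + a) =
      (∫ s in (0 : ℝ)..T, p s) + T * a := by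
    intro i a
    rw [intervalIntegral.integral_add ((hp.fun_add (hwcont i)).intervalIntegrable _ _)
      intervalIntegrable_const, intervalIntegral.integral_add (hp.intervalIntegrable _ _)
      ((hwcont i).intervalIntegrable _ _), hwint i]
    simp
  rcases le_or_gt 0 (∫ s in (0 : ℝ)..T, p s) with hpi | hpi
  · have hall : ∀ i t, 0 ≤ p t + w i t := fun i => (hsign i).resolve_right fun hneg => by
      have h1 : ∫ s in (0 : ℝ)..T, -(p s + w i s + c) = -((∫ s in (0 : ℝ)..T, p s) + T * c) := by
        rw [intervalIntegral.integral_neg, hint i c]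
      have h2 : 0 ≤ ∫ s in (0 : ℝ)..T, -(p s + w i s + c) :=
        intervalIntegral.integral_nonneg hT.le fun t _ => neg_nonneg.2 (hneg t)
      nlinarith
    refine false_of_periodic_drift (d := x) (g := f) (h := fun t => (B t - ∑ i, μp i t) / M)
      (t₀ := t₀) (C := p t₀ + c) hT hf ?_ ?_ ?_ ?_ ?_
    · filter_upwards [hfG] with t htf ht
      obtain ⟨u, hu, hfu⟩ := htf ht
      have hxt := hpx t ht
      have : ∀ i, u i = -μp i t := fun i => by
        have : u i ∈ dryF (μp i) (μm i) t (x t + w i t) := hu i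
        rwa [dryF, if_pos (by linarith [hall i t]), mem_singleton_iff] at this
      rw [hfu]
      simp [this, sub_eq_add_neg]
    · have := fun i => (hμcont i).1
      fun_prop
    · intro t
      simp only [hBper t, (hμper _).1 t]
    · rw [intervalIntegral.integral_div]
      exact div_neg_of_neg_of_pos hBp hM
    · intro k
      rw [← hpk k]
      exact hpx _ (hle k)
  · have hall : ∀ i t, p t + w i t + c ≤ 0 := fun i => (hsign i).resolve_left fun hnn => by
      have h1 := hint i 0
      simp only [add_zero, mul_zero] at h1
      have h2 : 0 ≤ ∫ s in (0 : ℝ)..T, (p s + w i s) :=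
        intervalIntegral.integral_nonneg hT.le fun t _ => hnn t
      linarith
    refine false_of_periodic_drift (d := fun t => -y t) (g := fun t => -g t)
      (h := fun t => -((B t + ∑ i, μm i t) / M)) (t₀ := t₀) (C := -p t₀) hT ?_ ?_ ?_ ?_ ?_ ?_
    · intro a ha b hb hab
      obtain ⟨hgi, hge⟩ := hg a ha b hb hab
      refine ⟨hgi.neg, ?_⟩
      rw [intervalIntegral.integral_neg]
      linarith
    · filter_upwards [hgG] with t htg ht
      obtain ⟨u, hu, hgu⟩ := htg ht
      have hyt := hyp t ht
      have : ∀ i, u i = μm i t := fun i => by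
        have : u i ∈ dryF (μp i) (μm i) t (y t + w i t) := hu i
        rwa [dryF, if_neg (by linarith [hall i t]), if_pos (by linarith [hall i t]),
          mem_singleton_iff] at this
      rw [hgu]
      simp [this]
    · have := fun i => (hμcont i).2
      fun_prop
    · intro t
      simp only [hBper t, (hμper _).2 t]
    · rw [intervalIntegral.integral_neg, intervalIntegral.integral_div]
      exact neg_neg_of_pos (div_pos hBm hM)
    · intro k
      rw [← hpk k]
      exact neg_le_neg (hyp _ (hle k))

theorem crawler_tendsto_sub_zero {T : ℝ} (hT : 0 < T) {n : ℕ} {M : ℝ} (hM : 0 < M)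
    {μp μm : Fin n → ℝ → ℝ}
    (hμcont : ∀ i, Continuous (μp i) ∧ Continuous (μm i))
    (hμper : ∀ i, Function.Periodic (μp i) T ∧ Function.Periodic (μm i) T)
    (hμpos : ∀ i t, 0 < μp i t ∧ 0 < μm i t)
    {w : Fin n → ℝ → ℝ} (hwcont : ∀ i, Continuous (w i)) (hwper : ∀ i, Function.Periodic (w i) T)
    (hwint : ∀ i, ∫ s in (0 : ℝ)..T, w i s = 0)
    {B : ℝ → ℝ} (hBcont : Continuous B) (hBper : Function.Periodic B T)
    (hBp : ∫ s in (0 : ℝ)..T, (B s - ∑ i, μp i s) < 0)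
    (hBm : 0 < ∫ s in (0 : ℝ)..T, (B s + ∑ i, μm i s))
    {v p : ℝ → ℝ} {t₀ : ℝ} (hpper : Function.Periodic p T)
    (hp : IsSolOn (crawlerG n M B w fun i => dryF (μp i) (μm i)) p univ)
    (hv : IsSolOn (crawlerG n M B w fun i => dryF (μp i) (μm i)) v (Ici t₀)) :
    Tendsto (fun t => v t - p t) atTop (𝓝 0) := by
  have hpI : ∀ a, IsSolOn (crawlerG n M B w fun i => dryF (μp i) (μm i)) p (Ici a) :=
    fun a => hp.mono (subset_univ _)
  have hpc : Continuous p := continuous_iff_continuousAt.2 fun t =>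
    (hpI (t - 1)).continuousOn_Ici.continuousAt (Ici_mem_nhds (by linarith))
  have hG : ∀ t a b f g, b < a → f ∈ crawlerG n M B w (fun i => dryF (μp i) (μm i)) t a →
      g ∈ crawlerG n M B w (fun i => dryF (μp i) (μm i)) t b → f ≤ g :=
    fun t a b f g => crawlerG_le_of_lt hM hμpos
  have hpos : ∀ a b, t₀ ≤ a → a ≤ b → p b < v b → v b - p b ≤ v a - p a :=
    fun a b ha hab => IsSolOn.sub_le_sub_of_pos hG hv (hpI t₀) ha hab
  have hneg : ∀ a b, t₀ ≤ a → a ≤ b → v b < p b → p b - v b ≤ p a - v a :=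
    fun a b ha hab => IsSolOn.sub_le_sub_of_pos hG (hpI t₀) hv ha hab
  have hanti : ∀ a b, t₀ ≤ a → a ≤ b → |v b - p b| ≤ |v a - p a| := by
    intro a b ha hab
    rcases lt_trichotomy (v b) (p b) with h | h | h
    · rw [abs_of_neg (sub_neg.2 h), abs_sub_comm]
      exact (by linarith [hneg a b ha hab h] : _ ≤ p a - v a).trans (le_abs_self _)
    · simp [h]
    · rw [abs_of_pos (sub_pos.2 h)]
      exact (hpos a b ha hab h).trans (le_abs_self _)
  by_cases hsmall : ∀ c > 0, ∃ t, t₀ ≤ t ∧ |v t - p t| < c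
  · rw [Metric.tendsto_atTop]
    intro ε hε
    obtain ⟨s, hs, hlt⟩ := hsmall ε hε
    refine ⟨s, fun t ht => ?_⟩
    rw [Real.dist_eq, sub_zero]
    exact (hanti s t hs ht).trans_lt hlt
  exfalso
  push Not at hsmall
  obtain ⟨c, hc, hcle⟩ := hsmall
  by_cases hex : ∃ t, t₀ ≤ t ∧ v t < p t
  · obtain ⟨s, hs, hsv⟩ := hex
    have hlt : ∀ t, s ≤ t → v t < p t := by
      intro t ht
      by_contra! hcon
      have h1 := hcle t (hs.trans ht)
      rw [abs_of_nonneg (sub_nonneg.2 hcon)] at h1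
      linarith [hpos s t hs ht (by linarith)]
    refine crawler_false_of_separated hT hM hμcont hμper hμpos hwcont hwper hwint hBcont hBper
      hBp hBm hc (p := fun t => p t - c) (t₀ := s) (hpc.sub continuous_const)
      (fun t => by simp [hpper t]) (hpI s) (hv.mono (Ici_subset_Ici.2 hs)) (fun t ht => ?_)
      fun t ht => by simp
    have h1 := hcle t (hs.trans ht)
    rw [abs_of_neg (sub_neg.2 (hlt t ht))] at h1
    linarith
  · push Not at hex
    refine crawler_false_of_separated hT hM hμcont hμper hμpos hwcont hwper hwint hBcont hBper
      hBp hBm hc hpc hpper hv (hpI t₀) (fun t _ => le_rfl) fun t ht => ?_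
    have h1 := hcle t ht
    rw [abs_of_nonneg (sub_nonneg.2 (hex t ht))] at h1
    linarith

theorem exists_periodic_isSolOn {G : ℝ → ℝ → Set ℝ} {T : ℝ} (hT : 0 < T)
    (hG : Function.Periodic G T) {v : ℝ → ℝ} (hv : AbsolutelyContinuousOnInterval v 0 T)
    (hv0 : v T = v 0) (hvG : ∀ᵐ t ∂(volume : Measure ℝ), t ∈ Ioo 0 T → deriv v t ∈ G t (v t)) :
    ∃ u, IsSolOn G u univ ∧ Function.Periodic u T := by
  set g : ℝ → ℝ := fun t => deriv v (toIcoMod hT 0 t) with hg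
  have hgper : Function.Periodic g T := fun t => by simp [hg]
  have hgeq : ∀ t ∈ Ico 0 T, g t = deriv v t := fun t ht => by
    simp only [hg]
    rw [(toIcoMod_eq_self hT).2 (by simpa using ht)]
  have hint : ∀ t ∈ Icc 0 T, ∫ s in (0 : ℝ)..t, g s = v t - v 0 := by
    intro t ht
    have hac : AbsolutelyContinuousOnInterval v 0 t :=
      hv.mono (by rw [uIcc_of_le ht.1, uIcc_of_le hT.le]; exact Icc_subset_Icc_right ht.2)
    rw [← hac.integral_deriv_eq_sub]
    refine intervalIntegral.integral_congr_Ioo_of_le ht.1 fun s hs =>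
      hgeq s ⟨hs.1.le, hs.2.trans_le ht.2⟩
  have hgi : ∀ a b, IntervalIntegrable g volume a b := by
    refine fun a b => hgper.intervalIntegrable₀ hT.ne' ?_ a b
    refine IntervalIntegrable.congr_uIoo hv.intervalIntegrable_deriv fun t ht => ?_
    rw [uIoo_of_le hT.le] at ht
    exact (hgeq t (Ioo_subset_Ico_self ht)).symm
  set u : ℝ → ℝ := fun t => v 0 + ∫ s in (0 : ℝ)..t, g s with hu
  have huv : ∀ t ∈ Icc 0 T, u t = v t := fun t ht => by simp [hu, hint t ht]
  have hsub : ∀ a b, u b - u a = ∫ s in a..b, g s := fun a b => by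
    rw [← intervalIntegral.integral_interval_sub_left (hgi 0 b) (hgi 0 a)]
    simp [hu]
  have huper : Function.Periodic u T := fun t => by
    have h := hsub t (t + T)
    rw [hgper.intervalIntegral_add_eq t 0, zero_add, hint T ⟨hT.le, le_rfl⟩, hv0] at h
    linarith
  refine ⟨u, ⟨g, fun a _ b _ _ => ⟨hgi a b, hsub a b⟩, ?_⟩, huper⟩
  have hbase : ∀ᵐ t ∂(volume : Measure ℝ), t ∈ Ico 0 T → g t ∈ G t (u t) := by
    filter_upwards [hvG, Measure.ae_ne volume (0 : ℝ)] with t ht ht0 hmem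
    rw [hgeq t hmem, huv t (Ico_subset_Icc_self hmem)]
    exact ht ⟨lt_of_le_of_ne hmem.1 (Ne.symm ht0), hmem.2⟩
  have hshift : ∀ᵐ t ∂(volume : Measure ℝ), ∀ k : ℤ,
      t - k • T ∈ Ico 0 T → g (t - k • T) ∈ G (t - k • T) (u (t - k • T)) :=
    ae_all_iff.2 fun k =>
      (measurePreserving_sub_right volume (k • T)).quasiMeasurePreserving.ae hbase
  filter_upwards [hshift] with t ht _
  have h := ht (toIcoDiv hT 0 t) (by
    have := toIcoMod_mem_Ico hT 0 t
    rwa [zero_add] at this)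
  rwa [hgper.sub_zsmul_eq, huper.sub_zsmul_eq, hG.sub_zsmul_eq] at h

theorem deriv_le_of_tendsto {α : ℕ → ℝ → ℝ} {f : ℕ → ℝ → ℝ → ℝ} {l : Filter ℕ} [l.NeBot]
    {v : ℝ → ℝ} {a b L : ℝ}
    (hα : ∀ k, ∀ t ∈ Icc a b, HasDerivWithinAt (α k) (f k t (α k t)) (Icc a b) t)
    (hL : ∀ k, ∀ t ∈ Icc a b, |f k t (α k t)| ≤ L)
    (hlim : ∀ t ∈ Icc a b, Tendsto (fun k => α k t) l (𝓝 (v t)))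
    {t d H : ℝ} (ht : t ∈ Ioo a b) (hd : HasDerivAt v d t)
    (hH : ∀ᶠ q : ℕ × ℝ × ℝ in l ×ˢ (𝓝 t ×ˢ 𝓝 (v t)), f q.1 q.2.1 q.2.2 ≤ H) : d ≤ H := by
  obtain ⟨A, hA, S, hS, hAS⟩ := eventually_prod_iff.1 hH
  rw [← nhds_prod_eq] at hS
  obtain ⟨δ, hδ, hball⟩ := Metric.eventually_nhds_iff.1 hS
  have hL0 : 0 ≤ L := (abs_nonneg _).trans (hL 0 t (Ioo_subset_Icc_self ht))
  have hlip : ∀ k, ∀ s ∈ Icc a b, |α k s - α k t| ≤ L * |s - t| := fun k s hs =>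
    (convex_Icc a b).norm_image_sub_le_of_norm_hasDerivWithin_le (hα k) (hL k)
      (Ioo_subset_Icc_self ht) hs
  set η := min δ (min (b - t) (δ / (2 * (L + 1)))) with hη
  have hη0 : 0 < η := by
    have := ht.2
    refine lt_min hδ (lt_min (by linarith) (by positivity))
  have hinc : ∀ s ∈ Ioo t (t + η), v s - v t ≤ H * (s - t) := by
    intro s hs
    have hs1 : s - t < δ := by linarith [hs.2, min_le_left δ (min (b - t) (δ / (2 * (L + 1))))]
    have hη2 : η ≤ min (b - t) (δ / (2 * (L + 1))) := min_le_right _ _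
    have hs2 : s < b := by linarith [hs.2, min_le_left (b - t) (δ / (2 * (L + 1)))]
    have hs3 : L * (s - t) < δ / 2 := by
      have h : s - t < δ / (2 * (L + 1)) := by
        linarith [hs.2, min_le_right (b - t) (δ / (2 * (L + 1)))]
      rw [lt_div_iff₀ (by positivity)] at h
      nlinarith [hs.1]
    have hsab : s ∈ Icc a b := ⟨(ht.1.trans hs.1).le, hs2.le⟩
    have htab : t ∈ Icc a b := Ioo_subset_Icc_self ht
    refine le_of_tendsto ((hlim s hsab).sub (hlim t htab)) ?_
    filter_upwards [hA, Metric.tendsto_nhds.1 (hlim t htab) (δ / 2) (half_pos hδ)] with k hk hkt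
    have hsub : Icc t s ⊆ Icc a b := Icc_subset_Icc ht.1.le hs2.le
    have hder : ∀ r ∈ interior (Icc t s), HasDerivAt (α k) (f k r (α k r)) r := by
      intro r hr
      rw [interior_Icc] at hr
      exact (hα k r (hsub (Ioo_subset_Icc_self hr))).hasDerivAt
        (Icc_mem_nhds (ht.1.trans hr.1) (hr.2.trans hs2))
    refine (convex_Icc t s).image_sub_le_mul_sub_of_deriv_le
      (fun r hr => ((hα k r (hsub hr)).continuousWithinAt).mono hsub)
      (fun r hr => (hder r hr).differentiableAt.differentiableWithinAt) (fun r hr => ?_)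
      t ⟨le_rfl, hs.1.le⟩ s ⟨hs.1.le, le_rfl⟩ hs.1.le
    rw [(hder r hr).deriv]
    rw [interior_Icc] at hr
    refine hAS hk (y := (r, α k r)) (hball ?_)
    have hrt : |r - t| ≤ s - t := by
      rw [abs_of_pos (sub_pos.2 hr.1)]
      linarith [hr.2]
    rw [Prod.dist_eq, max_lt_iff, Real.dist_eq, Real.dist_eq]
    rw [Real.dist_eq] at hkt
    refine ⟨by linarith, ?_⟩
    have h1 := hlip k r (hsub (Ioo_subset_Icc_self hr))
    have h2 : L * |r - t| ≤ L * (s - t) := by gcongr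
    have h3 := abs_sub_le (α k r) (α k t) (v t)
    linarith
  have hslope := (hasDerivWithinAt_iff_tendsto_slope' self_notMem_Ioi).1
    (hd.hasDerivWithinAt (s := Ioi t))
  refine le_of_tendsto hslope ?_
  filter_upwards [Ioo_mem_nhdsGT (by linarith : t < t + η)] with s hs
  rw [slope_def_field, div_le_iff₀ (by linarith [hs.1])]
  exact hinc s hs

theorem le_deriv_of_tendsto {α : ℕ → ℝ → ℝ} {f : ℕ → ℝ → ℝ → ℝ} {l : Filter ℕ} [l.NeBot]
    {v : ℝ → ℝ} {a b L : ℝ}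
    (hα : ∀ k, ∀ t ∈ Icc a b, HasDerivWithinAt (α k) (f k t (α k t)) (Icc a b) t)
    (hL : ∀ k, ∀ t ∈ Icc a b, |f k t (α k t)| ≤ L)
    (hlim : ∀ t ∈ Icc a b, Tendsto (fun k => α k t) l (𝓝 (v t)))
    {t d H : ℝ} (ht : t ∈ Ioo a b) (hd : HasDerivAt v d t)
    (hH : ∀ᶠ q : ℕ × ℝ × ℝ in l ×ˢ (𝓝 t ×ˢ 𝓝 (v t)), H ≤ f q.1 q.2.1 q.2.2) : H ≤ d := by
  have hneg : Tendsto (fun q : ℕ × ℝ × ℝ => (q.1, q.2.1, -q.2.2)) (l ×ˢ (𝓝 t ×ˢ 𝓝 (-v t)))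
      (l ×ˢ (𝓝 t ×ˢ 𝓝 (v t))) := by
    have : Tendsto (fun x : ℝ => -x) (𝓝 (-v t)) (𝓝 (v t)) := by
      simpa using (continuous_neg.tendsto (-v t))
    exact tendsto_id.prodMap (tendsto_id.prodMap this)
  have := deriv_le_of_tendsto (α := fun k s => -α k s) (f := fun k s x => -f k s (-x))
    (l := l) (v := fun s => -v s) (a := a) (b := b) (L := L) (H := -H)
    (fun k s hs => by simpa using (hα k s hs).fun_neg) (fun k s hs => by simpa using hL k s hs)
    (fun s hs => (hlim s hs).neg) ht hd.neg
    ((hneg.eventually hH).mono fun q hq => neg_le_neg hq)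
  linarith

theorem exists_periodic_ode_solution {f : ℝ → ℝ → ℝ} {φ ψ : ℝ → ℝ} {T R : ℝ} {K L : ℝ≥0}
    (hT : 0 < T) (hR : 0 ≤ R)
    (hlip : ∀ t ∈ Icc 0 T, LipschitzWith K (f t)) (hcont : ∀ x, Continuous (f · x))
    (hL : ∀ t ∈ Icc 0 T, ∀ x, |f t x| ≤ L)
    (hφ : Continuous φ) (hψ : Continuous ψ)
    (hfφ : ∀ t ∈ Icc 0 T, ∀ x, R ≤ x → f t x = φ t)
    (hfψ : ∀ t ∈ Icc 0 T, ∀ x, x ≤ -R → f t x = ψ t)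
    (hφi : ∫ t in (0 : ℝ)..T, φ t ≤ 0) (hψi : 0 ≤ ∫ t in (0 : ℝ)..T, ψ t) :
    ∃ α : ℝ → ℝ, α T = α 0 ∧ |α 0| ≤ R + L * T ∧
      ∀ t ∈ Icc 0 T, HasDerivWithinAt α (f t (α t)) (Icc 0 T) t := by
  lift R to ℝ≥0 using hR
  lift T to ℝ≥0 using hT.le
  have h0 : (0 : ℝ) ∈ Icc 0 (T : ℝ) := ⟨le_rfl, hT.le⟩
  have hTm : (T : ℝ) ∈ Icc 0 (T : ℝ) := ⟨hT.le, le_rfl⟩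
  have hPL : IsPicardLindelof f (tmin := 0) (tmax := T) ⟨0, h0⟩ 0 (R + L * T + L * T) (R + L * T)
      L K :=
    { lipschitzOnWith := fun t ht => (hlip t ht).lipschitzOnWith
      continuousOn := fun x _ => (hcont x).continuousOn
      norm_le := fun t ht x _ => hL t ht x
      mul_max_le := by simp }
  obtain ⟨α, hα, hαc⟩ := hPL.exists_forall_mem_closedBall_eq_hasDerivWithinAt_continuousOn
  set r : ℝ := R + L * T with hr
  have hr0 : 0 ≤ r := by positivity
  have hball : ∀ x, x ∈ Metric.closedBall (0 : ℝ) ↑(R + L * T) ↔ |x| ≤ r := fun x => by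
    simp [hr]
  have hbound : ∀ x, |x| ≤ r → ∀ t ∈ Icc 0 (T : ℝ), |α (x, t) - x| ≤ L * T := by
    intro x hx t ht
    obtain ⟨hi, hder⟩ := hα x ((hball x).2 hx)
    have h1 := (convex_Icc 0 (T : ℝ)).norm_image_sub_le_of_norm_hasDerivWithin_le hder
      (fun s hs => hL s hs _) h0 ht
    rw [hi, Real.norm_eq_abs, Real.norm_eq_abs, sub_zero, abs_of_nonneg ht.1] at h1
    exact h1.trans (by gcongr; exact ht.2)
  have hinc : ∀ x, |x| ≤ r → ∀ χ : ℝ → ℝ, Continuous χ →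
      (∀ t ∈ Icc 0 (T : ℝ), f t (α (x, t)) = χ t) →
      α (x, T) - x = ∫ t in (0 : ℝ)..T, χ t := by
    intro x hx χ hχ heq
    obtain ⟨hi, hder⟩ := hα x ((hball x).2 hx)
    rw [intervalIntegral.integral_eq_sub_of_hasDerivAt_of_le hT.le (f := fun t => α (x, t))
      (fun t ht => (hder t ht).continuousWithinAt) (fun t ht => ?_) (hχ.intervalIntegrable _ _)]
    · exact congrArg _ hi.symm
    · have := hder t (Ioo_subset_Icc_self ht)
      rw [heq t (Ioo_subset_Icc_self ht)] at this
      exact this.hasDerivAt (Icc_mem_nhds ht.1 ht.2)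
  have htop : α (r, T) - r ≤ 0 := by
    have hrr : |r| ≤ r := (abs_of_nonneg hr0).le
    rw [hinc r hrr φ hφ fun t ht => hfφ t ht _ ?_]
    · exact hφi
    · linarith [(abs_le.1 (hbound r hrr t ht)).1]
  have hbot : 0 ≤ α (-r, T) - -r := by
    have hrr : |-r| ≤ r := by rw [abs_neg, abs_of_nonneg hr0]
    rw [hinc (-r) hrr ψ hψ fun t ht => hfψ t ht _ ?_]
    · exact hψi
    · linarith [(abs_le.1 (hbound (-r) hrr t ht)).2]
  have hPc : ContinuousOn (fun x => α (x, (T : ℝ)) - x) (Icc (-r) r) := by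
    refine ContinuousOn.sub (hαc.comp (by fun_prop) fun x hx => ⟨?_, hTm⟩) continuousOn_id
    exact (hball x).2 (abs_le.2 hx)
  obtain ⟨x, hx, hx0⟩ := intermediate_value_Icc' (by linarith) hPc ⟨htop, hbot⟩
  have hxr : |x| ≤ r := abs_le.2 hx
  obtain ⟨hi, hder⟩ := hα x ((hball x).2 hxr)
  refine ⟨fun t => α (x, t), ?_, ?_, hder⟩
  · exact (sub_eq_zero.1 hx0).trans hi.symm
  · exact (congrArg abs hi).trans_le hxr

/-- Lipschitz regularization of `dryF`: it agrees with `dryF` for `(k + 1) * |u| ≥ 1` and is affine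
in `u` in between. -/
noncomputable def regDryF (k : ℕ) (μp μm : ℝ → ℝ) (t u : ℝ) : ℝ :=
  ((μm t - μp t) - (μp t + μm t) * max (-1) (min 1 ((k + 1) * u))) / 2

theorem regDryF_of_one_le {k : ℕ} {μp μm : ℝ → ℝ} {t u : ℝ} (h : 1 ≤ (k + 1) * u) :
    regDryF k μp μm t u = -μp t := by
  rw [regDryF, min_eq_left h, max_eq_right (by norm_num)]
  ring

theorem regDryF_of_le_neg_one {k : ℕ} {μp μm : ℝ → ℝ} {t u : ℝ} (h : (k + 1) * u ≤ -1) :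
    regDryF k μp μm t u = μm t := by
  rw [regDryF, min_eq_right (by linarith), max_eq_left h]
  ring

theorem regDryF_mem_Icc {k : ℕ} {μp μm : ℝ → ℝ} {t u : ℝ} (hμ : 0 < μp t ∧ 0 < μm t) :
    regDryF k μp μm t u ∈ Icc (-μp t) (μm t) := by
  have h1 : -1 ≤ max (-1) (min 1 ((k + 1) * u)) := le_max_left _ _
  have h2 : max (-1) (min 1 ((k + 1) * u)) ≤ 1 := max_le (by norm_num) (min_le_left _ _)
  constructor <;> rw [regDryF] <;> nlinarith [hμ.1, hμ.2]

theorem abs_regDryF_sub_le {k : ℕ} {μp μm : ℝ → ℝ} {t u v : ℝ} (hμ : 0 < μp t ∧ 0 < μm t) :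
    |regDryF k μp μm t u - regDryF k μp μm t v| ≤ (μp t + μm t) * ((k + 1) * |u - v|) := by
  have hclamp : ∀ a b : ℝ, |max (-1) (min 1 a) - max (-1) (min 1 b)| ≤ |a - b| := by
    intro a b
    grind
  have h := hclamp ((k + 1) * u) ((k + 1) * v)
  rw [← mul_sub, abs_mul, abs_of_pos (by positivity : (0 : ℝ) < k + 1)] at h
  have hpos : 0 < μp t + μm t := add_pos hμ.1 hμ.2
  have heq : regDryF k μp μm t u - regDryF k μp μm t v = (μp t + μm t) *
      -((max (-1) (min 1 ((k + 1) * u)) - max (-1) (min 1 ((k + 1) * v))) / 2) := by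
    simp only [regDryF]
    ring
  rw [heq, abs_mul, abs_of_pos hpos, abs_neg, abs_div, abs_two]
  gcongr
  linarith [abs_nonneg (max (-1) (min 1 ((k + 1) * u)) - max (-1) (min 1 ((k + 1) * v)))]

theorem eventually_one_le_mul {u : ℝ} (hu : 0 < u) :
    ∀ᶠ q : ℕ × ℝ in atTop ×ˢ 𝓝 u, 1 ≤ (q.1 + 1) * q.2 := by
  obtain ⟨N, hN⟩ := exists_nat_gt (2 / u)
  filter_upwards [(eventually_ge_atTop N).prod_mk (lt_mem_nhds (half_lt_self hu))] with q hq
  have h1 : (N : ℝ) ≤ q.1 := Nat.cast_le.2 hq.1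
  rw [div_lt_iff₀ hu] at hN
  nlinarith [hq.2]

theorem eventually_regDryF_le {μp μm : ℝ → ℝ} (hp : Continuous μp) (hm : Continuous μm)
    (hμ : ∀ t, 0 < μp t ∧ 0 < μm t) (t u : ℝ) {ε : ℝ} (hε : 0 < ε) :
    ∀ᶠ q : ℕ × ℝ × ℝ in atTop ×ˢ (𝓝 t ×ˢ 𝓝 u),
      regDryF q.1 μp μm q.2.1 q.2.2 ≤ (if 0 < u then -μp t else μm t) + ε := by
  have hs : Tendsto (fun q : ℕ × ℝ × ℝ => q.2.1) (atTop ×ˢ (𝓝 t ×ˢ 𝓝 u)) (𝓝 t) :=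
    tendsto_fst.comp tendsto_snd
  have hu : Tendsto (fun q : ℕ × ℝ × ℝ => (q.1, q.2.2)) (atTop ×ˢ (𝓝 t ×ˢ 𝓝 u))
      (atTop ×ˢ 𝓝 u) := tendsto_fst.prodMk (tendsto_snd.comp tendsto_snd)
  split_ifs with h
  · filter_upwards [hu.eventually (eventually_one_le_mul h),
      ((hp.neg.tendsto t).comp hs).eventually_lt_const (by linarith : -μp t < -μp t + ε)]
      with q hq hq'
    rw [regDryF_of_one_le hq]
    exact hq'.le
  · filter_upwards [((hm.tendsto t).comp hs).eventually_lt_const (by linarith : μm t < μm t + ε)]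
      with q hq
    exact (regDryF_mem_Icc (hμ _)).2.trans hq.le

theorem regDryF_neg (k : ℕ) (μp μm : ℝ → ℝ) (t u : ℝ) :
    regDryF k μm μp t (-u) = -regDryF k μp μm t u := by
  have : max (-1) (min 1 ((k + 1) * -u)) = -max (-1) (min 1 ((k + 1) * u)) := by grind
  rw [regDryF, regDryF, this]
  ring

theorem mem_crawlerG_of_mem_Icc {n : ℕ} {M : ℝ} (hM : 0 < M) {B : ℝ → ℝ}
    {w μp μm : Fin n → ℝ → ℝ} (hμ : ∀ i t, 0 < μp i t ∧ 0 < μm i t) {t v d : ℝ}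
    (hlo : (B t + ∑ i, if v + w i t < 0 then μm i t else -μp i t) / M ≤ d)
    (hhi : d ≤ (B t + ∑ i, if 0 < v + w i t then -μp i t else μm i t) / M) :
    d ∈ crawlerG n M B w (fun i => dryF (μp i) (μm i)) t v := by
  set lo : Fin n → ℝ := fun i => if v + w i t < 0 then μm i t else -μp i t
  set hi : Fin n → ℝ := fun i => if 0 < v + w i t then -μp i t else μm i t
  rw [div_le_iff₀ hM] at hlo
  rw [le_div_iff₀ hM] at hhi
  have hcont : ContinuousOn (fun θ : ℝ => ∑ i, (lo i + θ * (hi i - lo i))) (Icc 0 1) := by fun_prop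
  obtain ⟨θ, hθ, hsum⟩ := intermediate_value_Icc zero_le_one hcont
    (show d * M - B t ∈ Icc _ _ from ⟨by simp; linarith, by simp; linarith⟩)
  refine ⟨fun i => lo i + θ * (hi i - lo i), fun i => ?_, ?_⟩
  · have := (hμ i t).1
    have := (hμ i t).2
    simp only [dryF, lo, hi]
    split_ifs
    · exfalso; linarith
    · simp
    · simp
    · constructor <;> nlinarith [hθ.1, hθ.2]
  · rw [eq_div_iff hM.ne']
    simp only at hsum
    linarith

/-- The vector field of the crawler with regularized friction. -/
noncomputable def regCrawler {n : ℕ} (M : ℝ) (B : ℝ → ℝ) (w μp μm : Fin n → ℝ → ℝ) (k : ℕ)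
    (t v : ℝ) : ℝ :=
  (B t + ∑ i, regDryF k (μp i) (μm i) t (v + w i t)) / M

section

variable {n : ℕ} {M : ℝ} {B : ℝ → ℝ} {w μp μm : Fin n → ℝ → ℝ}

theorem tendsto_add_shift (l : Filter ℕ) {f : ℝ → ℝ} (hf : Continuous f) (t v : ℝ) :
    Tendsto (fun q : ℕ × ℝ × ℝ => (q.1, q.2.1, q.2.2 + f q.2.1)) (l ×ˢ (𝓝 t ×ˢ 𝓝 v))
      (l ×ˢ (𝓝 t ×ˢ 𝓝 (v + f t))) := by
  have : Tendsto (fun q : ℝ × ℝ => (q.1, q.2 + f q.1)) (𝓝 t ×ˢ 𝓝 v) (𝓝 t ×ˢ 𝓝 (v + f t)) := by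
    rw [← nhds_prod_eq, ← nhds_prod_eq]
    exact Continuous.tendsto' (by fun_prop) _ _ rfl
  exact tendsto_id.prodMap this

theorem eventually_regCrawler_le (hM : 0 < M)
    (hμcont : ∀ i, Continuous (μp i) ∧ Continuous (μm i))
    (hμpos : ∀ i t, 0 < μp i t ∧ 0 < μm i t) (hwcont : ∀ i, Continuous (w i))
    (hBcont : Continuous B) (t v : ℝ) {ε : ℝ} (hε : 0 < ε) :
    ∀ᶠ q : ℕ × ℝ × ℝ in atTop ×ˢ (𝓝 t ×ˢ 𝓝 v), regCrawler M B w μp μm q.1 q.2.1 q.2.2 ≤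
      (B t + ∑ i, if 0 < v + w i t then -μp i t else μm i t) / M + ε := by
  obtain ⟨δ, hδ, hδε⟩ : ∃ δ > 0, (δ + n * δ) / M ≤ ε := by
    refine ⟨ε * M / (1 + n), by positivity, le_of_eq ?_⟩
    field_simp
  have hF := eventually_all.2 fun i => (tendsto_add_shift atTop (hwcont i) t v).eventually
    (eventually_regDryF_le (hμcont i).1 (hμcont i).2 (hμpos i) t (v + w i t) hδ)
  have hB := ((hBcont.tendsto t).comp (tendsto_fst.comp tendsto_snd :
    Tendsto (fun q : ℕ × ℝ × ℝ => q.2.1) (atTop ×ˢ (𝓝 t ×ˢ 𝓝 v)) (𝓝 t))).eventually_lt_const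
    (by linarith : B t < B t + δ)
  filter_upwards [hF, hB] with q hq hqB
  have hsum := Finset.sum_le_sum fun i (_ : i ∈ Finset.univ) => hq i
  simp only [Finset.sum_add_distrib, Finset.sum_const, Finset.card_univ, Fintype.card_fin,
    nsmul_eq_mul] at hsum
  simp only [Function.comp_apply] at hqB
  have hle : regCrawler M B w μp μm q.1 q.2.1 q.2.2 ≤
      (B t + (∑ i, if 0 < v + w i t then -μp i t else μm i t) + (δ + n * δ)) / M :=
    div_le_div_of_nonneg_right (by linarith) hM.le
  rw [add_div] at hle
  linarith

theorem regCrawler_neg (k : ℕ) (t v : ℝ) :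
    regCrawler M (fun t => -B t) (fun i t => -w i t) μm μp k t (-v) =
      -regCrawler M B w μp μm k t v := by
  simp only [regCrawler, ← neg_add, regDryF_neg, Finset.sum_neg_distrib, neg_div]

theorem eventually_le_regCrawler (hM : 0 < M)
    (hμcont : ∀ i, Continuous (μp i) ∧ Continuous (μm i))
    (hμpos : ∀ i t, 0 < μp i t ∧ 0 < μm i t) (hwcont : ∀ i, Continuous (w i))
    (hBcont : Continuous B) (t v : ℝ) {ε : ℝ} (hε : 0 < ε) :
    ∀ᶠ q : ℕ × ℝ × ℝ in atTop ×ˢ (𝓝 t ×ˢ 𝓝 v),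
      (B t + ∑ i, if v + w i t < 0 then μm i t else -μp i t) / M - ε ≤
        regCrawler M B w μp μm q.1 q.2.1 q.2.2 := by
  have hneg : Tendsto (fun q : ℕ × ℝ × ℝ => (q.1, q.2.1, -q.2.2)) (atTop ×ˢ (𝓝 t ×ˢ 𝓝 v))
      (atTop ×ˢ (𝓝 t ×ˢ 𝓝 (-v))) :=
    tendsto_id.prodMap (tendsto_id.prodMap (continuous_neg.tendsto v))
  filter_upwards [hneg.eventually (eventually_regCrawler_le (B := fun t => -B t)
    (w := fun i t => -w i t) hM (fun i => (hμcont i).symm)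
    (fun i t => (hμpos i t).symm) (fun i => (hwcont i).neg) hBcont.neg t (-v) hε)] with q hq
  rw [regCrawler_neg] at hq
  have hterm : ∀ i, (if 0 < -v + -w i t then -μm i t else μp i t) =
      -(if v + w i t < 0 then μm i t else -μp i t) := fun i => by
    rw [← neg_add]
    simp only [Left.neg_pos_iff]
    split_ifs <;> simp
  simp only [hterm, Finset.sum_neg_distrib] at hq
  rw [← neg_add, neg_div] at hq
  linarith

theorem continuous_regCrawler (hμcont : ∀ i, Continuous (μp i) ∧ Continuous (μm i))
    (hwcont : ∀ i, Continuous (w i)) (hBcont : Continuous B) (k : ℕ) (x : ℝ) :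
    Continuous fun t => regCrawler M B w μp μm k t x := by
  have := fun i => (hμcont i).1
  have := fun i => (hμcont i).2
  unfold regCrawler regDryF
  fun_prop

theorem abs_regCrawler_le (hM : 0 < M) (hμpos : ∀ i t, 0 < μp i t ∧ 0 < μm i t) (k : ℕ)
    (t x : ℝ) : |regCrawler M B w μp μm k t x| ≤ (|B t| + ∑ i, (μp i t + μm i t)) / M := by
  rw [regCrawler, abs_div, abs_of_pos hM]
  refine div_le_div_of_nonneg_right ((abs_add_le _ _).trans ?_) hM.le
  gcongr
  refine (Finset.abs_sum_le_sum_abs _ _).trans (Finset.sum_le_sum fun i _ => ?_)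
  have h := regDryF_mem_Icc (k := k) (u := x + w i t) (hμpos i t)
  rw [abs_le]
  constructor <;> linarith [h.1, h.2, (hμpos i t).1, (hμpos i t).2]

theorem lipschitzWith_regCrawler (hM : 0 < M) (hμpos : ∀ i t, 0 < μp i t ∧ 0 < μm i t) (k : ℕ)
    {t : ℝ} {S : ℝ≥0} (hS : (∑ i, (μp i t + μm i t)) / M ≤ S) :
    LipschitzWith (S * (k + 1)) (regCrawler M B w μp μm k t) := by
  refine LipschitzWith.of_dist_le_mul fun x y => ?_
  have hsum : |∑ i, regDryF k (μp i) (μm i) t (x + w i t) -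
      ∑ i, regDryF k (μp i) (μm i) t (y + w i t)| ≤
      (∑ i, (μp i t + μm i t)) * ((k + 1) * |x - y|) := by
    rw [← Finset.sum_sub_distrib, Finset.sum_mul]
    refine (Finset.abs_sum_le_sum_abs _ _).trans (Finset.sum_le_sum fun i _ => ?_)
    simpa using abs_regDryF_sub_le (k := k) (u := x + w i t) (v := y + w i t) (hμpos i t)
  rw [Real.dist_eq, Real.dist_eq, regCrawler, regCrawler, ← sub_div, add_sub_add_left_eq_sub,
    abs_div, abs_of_pos hM]
  push_cast
  calc _ ≤ (∑ i, (μp i t + μm i t)) * ((k + 1) * |x - y|) / M :=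
        div_le_div_of_nonneg_right hsum hM.le
    _ = (∑ i, (μp i t + μm i t)) / M * ((k + 1) * |x - y|) := by ring
    _ ≤ S * ((k + 1) * |x - y|) := by gcongr
    _ = _ := by ring

theorem regCrawler_of_le {k : ℕ} {t x : ℝ} (hx : ∀ i, |w i t| + 1 ≤ x) :
    regCrawler M B w μp μm k t x = (B t - ∑ i, μp i t) / M := by
  rw [regCrawler, sub_eq_add_neg, ← Finset.sum_neg_distrib]
  congr 3 with i
  have h : 1 ≤ x + w i t := by linarith [hx i, neg_abs_le (w i t)]
  exact regDryF_of_one_le (one_le_mul_of_one_le_of_one_le (by simp) h)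

theorem regCrawler_of_le_neg {k : ℕ} {t x : ℝ} (hx : ∀ i, |w i t| + 1 ≤ -x) :
    regCrawler M B w μp μm k t x = (B t + ∑ i, μm i t) / M := by
  rw [regCrawler]
  congr 3 with i
  have h : 1 ≤ -(x + w i t) := by linarith [hx i, le_abs_self (w i t)]
  have : 1 ≤ ((k : ℝ) + 1) * -(x + w i t) := one_le_mul_of_one_le_of_one_le (by simp) h
  exact regDryF_of_le_neg_one (by linarith)

theorem exists_nnreal_bound {f : ℝ → ℝ} (hf : Continuous f) (T : ℝ) :
    ∃ C : ℝ≥0, ∀ t ∈ Icc 0 T, f t ≤ C := by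
  obtain ⟨C, hC⟩ := (isCompact_Icc (a := (0 : ℝ)) (b := T)).exists_bound_of_continuousOn
    hf.continuousOn
  exact ⟨C.toNNReal, fun t ht => (le_abs_self _).trans ((hC t ht).trans (Real.le_coe_toNNReal C))⟩

/-- The regularized crawlers have `T`-periodic solutions that are bounded uniformly in `k`. -/
theorem exists_periodic_regCrawler_solution {T : ℝ} (hT : 0 < T) (hM : 0 < M)
    (hμcont : ∀ i, Continuous (μp i) ∧ Continuous (μm i))
    (hμpos : ∀ i t, 0 < μp i t ∧ 0 < μm i t) (hwcont : ∀ i, Continuous (w i))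
    (hBcont : Continuous B) (hBp : ∫ s in (0 : ℝ)..T, (B s - ∑ i, μp i s) ≤ 0)
    (hBm : 0 ≤ ∫ s in (0 : ℝ)..T, (B s + ∑ i, μm i s)) :
    ∃ (α : ℕ → ℝ → ℝ) (C : ℝ) (L : ℝ≥0), (∀ k, α k T = α k 0) ∧ (∀ k, |α k 0| ≤ C) ∧
      (∀ k, ∀ t ∈ Icc 0 T, |regCrawler M B w μp μm k t (α k t)| ≤ L) ∧
      ∀ k, ∀ t ∈ Icc 0 T,
        HasDerivWithinAt (α k) (regCrawler M B w μp μm k t (α k t)) (Icc 0 T) t := by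
  have hp := fun i => (hμcont i).1
  have hm := fun i => (hμcont i).2
  obtain ⟨L, hL⟩ := exists_nnreal_bound
    (f := fun t => (|B t| + ∑ i, (μp i t + μm i t)) / M) (by fun_prop) T
  obtain ⟨S, hS⟩ := exists_nnreal_bound
    (f := fun t => (∑ i, (μp i t + μm i t)) / M) (by fun_prop) T
  obtain ⟨R, hR⟩ := exists_nnreal_bound (f := fun t => ∑ i, |w i t| + 1) (by fun_prop) T
  have hRw : ∀ t ∈ Icc 0 T, ∀ i, |w i t| + 1 ≤ R := fun t ht i => by
    have := Finset.single_le_sum (f := fun i => |w i t|) (fun j _ => abs_nonneg _)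
      (Finset.mem_univ i)
    have := hR t ht
    linarith
  have hbound : ∀ k, ∀ t ∈ Icc 0 T, ∀ x, |regCrawler M B w μp μm k t x| ≤ L :=
    fun k t ht x => (abs_regCrawler_le hM hμpos k t x).trans (hL t ht)
  have hsol := fun k => exists_periodic_ode_solution (f := regCrawler M B w μp μm k)
    (φ := fun t => (B t - ∑ i, μp i t) / M) (ψ := fun t => (B t + ∑ i, μm i t) / M) hT R.coe_nonneg
    (fun t ht => lipschitzWith_regCrawler hM hμpos k (hS t ht))
    (continuous_regCrawler hμcont hwcont hBcont k) (hbound k) (by fun_prop) (by fun_prop)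
    (fun t ht x hx => regCrawler_of_le fun i => (hRw t ht i).trans hx)
    (fun t ht x hx => regCrawler_of_le_neg fun i => (hRw t ht i).trans (le_neg_of_le_neg hx))
    (by rw [intervalIntegral.integral_div]; exact div_nonpos_of_nonpos_of_nonneg hBp hM.le)
    (by rw [intervalIntegral.integral_div]; exact div_nonneg hBm hM.le)
  choose α hα0 hαC hα using hsol
  exact ⟨α, _, L, hα0, hαC, fun k t ht => hbound k t ht _, hα⟩

end

theorem periodic_crawlerG {T : ℝ} {n : ℕ} {M : ℝ} {μp μm : Fin n → ℝ → ℝ}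
    (hμper : ∀ i, Function.Periodic (μp i) T ∧ Function.Periodic (μm i) T)
    {w : Fin n → ℝ → ℝ} (hwper : ∀ i, Function.Periodic (w i) T)
    {B : ℝ → ℝ} (hBper : Function.Periodic B T) :
    Function.Periodic (crawlerG n M B w fun i => dryF (μp i) (μm i)) T := by
  intro t
  ext v x
  simp only [crawlerG, dryF, hBper t, hwper _ t, (hμper _).1 t, (hμper _).2 t]

/-- A uniformly bounded sequence of uniformly Lipschitz functions converges pointwise along a
suitable ultrafilter. -/
theorem exists_tendsto_of_lipschitz {α : ℕ → ℝ → ℝ} {T C : ℝ} {L : ℝ≥0} (hT : 0 ≤ T)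
    (hC : ∀ k, |α k 0| ≤ C) (hL : ∀ k, LipschitzOnWith L (α k) (Icc 0 T)) :
    ∃ (l : Filter ℕ) (_ : l.NeBot) (v : ℝ → ℝ), l ≤ atTop ∧ LipschitzOnWith L v (Icc 0 T) ∧
      ∀ t ∈ Icc 0 T, Tendsto (fun k => α k t) l (𝓝 (v t)) := by
  have hlim : ∀ t ∈ Icc 0 T, ∃ x, Tendsto (fun k => α k t) (hyperfilter ℕ) (𝓝 x) := by
    intro t ht
    obtain ⟨x, -, hx⟩ := (isCompact_closedBall (0 : ℝ) (C + L * T)).ultrafilter_le_nhds'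
      ((hyperfilter ℕ).map fun k => α k t) (Filter.eventually_map.2 <| .of_forall fun k => by
        have h := (hL k).dist_le_mul t ht 0 ⟨le_rfl, hT⟩
        rw [Real.dist_eq, Real.dist_eq, sub_zero, abs_of_nonneg ht.1] at h
        have h1 : (L : ℝ) * t ≤ L * T := mul_le_mul_of_nonneg_left ht.2 L.coe_nonneg
        have h2 := abs_sub_abs_le_abs_sub (α k t) (α k 0)
        have h3 := hC k
        simp only [dist_zero_right, Real.norm_eq_abs]
        linarith)
    exact ⟨x, hx⟩
  choose! v hv using hlim
  refine ⟨hyperfilter ℕ, inferInstance, v, Nat.hyperfilter_le_atTop, ?_, hv⟩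
  refine LipschitzOnWith.of_dist_le_mul fun s hs t ht => ?_
  exact le_of_tendsto ((hv s hs).dist (hv t ht))
    (Filter.Eventually.of_forall fun k => (hL k).dist_le_mul s hs t ht)

theorem exists_periodic_crawler_solution {T : ℝ} (hT : 0 < T) {n : ℕ} {M : ℝ} (hM : 0 < M)
    {μp μm : Fin n → ℝ → ℝ}
    (hμcont : ∀ i, Continuous (μp i) ∧ Continuous (μm i))
    (hμper : ∀ i, Function.Periodic (μp i) T ∧ Function.Periodic (μm i) T)
    (hμpos : ∀ i t, 0 < μp i t ∧ 0 < μm i t)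
    {w : Fin n → ℝ → ℝ} (hwcont : ∀ i, Continuous (w i)) (hwper : ∀ i, Function.Periodic (w i) T)
    {B : ℝ → ℝ} (hBcont : Continuous B) (hBper : Function.Periodic B T)
    (hBp : ∫ s in (0 : ℝ)..T, (B s - ∑ i, μp i s) ≤ 0)
    (hBm : 0 ≤ ∫ s in (0 : ℝ)..T, (B s + ∑ i, μm i s)) :
    ∃ v, IsSolOn (crawlerG n M B w fun i => dryF (μp i) (μm i)) v univ ∧
      Function.Periodic v T := by
  obtain ⟨α, C, L, hα0, hαC, hαL, hα⟩ :=
    exists_periodic_regCrawler_solution hT hM hμcont hμpos hwcont hBcont hBp hBm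
  obtain ⟨l, hl, v, hlle, hvL, hv⟩ := exists_tendsto_of_lipschitz hT.le hαC fun k =>
    (convex_Icc 0 T).lipschitzOnWith_of_nnnorm_hasDerivWithin_le (hα k) (hαL k)
  have hac : AbsolutelyContinuousOnInterval v 0 T :=
    LipschitzOnWith.absolutelyContinuousOnInterval (by rwa [uIcc_of_le hT.le])
  refine exists_periodic_isSolOn hT (periodic_crawlerG hμper hwper hBper) hac ?_ ?_
  · refine tendsto_nhds_unique (hv T ⟨hT.le, le_rfl⟩) ?_
    simpa only [hα0] using hv 0 ⟨le_rfl, hT.le⟩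
  filter_upwards [hac.ae_differentiableAt] with t hdt ht
  have hd : HasDerivAt v (deriv v t) t :=
    (hdt (by rw [uIcc_of_le hT.le]; exact Ioo_subset_Icc_self ht)).hasDerivAt
  have hmono : l ×ˢ (𝓝 t ×ˢ 𝓝 (v t)) ≤ atTop ×ˢ (𝓝 t ×ˢ 𝓝 (v t)) := prod_mono_left _ hlle
  refine mem_crawlerG_of_mem_Icc hM hμpos (le_of_forall_pos_le_add fun ε hε => ?_)
    (le_of_forall_pos_le_add fun ε hε => ?_)
  · rw [← sub_le_iff_le_add]
    exact le_deriv_of_tendsto hα hαL hv ht hd (hmono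
      (eventually_le_regCrawler hM hμcont hμpos hwcont hBcont t (v t) hε))
  · exact deriv_le_of_tendsto hα hαL hv ht hd (hmono
      (eventually_regCrawler_le hM hμcont hμpos hwcont hBcont t (v t) hε))

theorem eq_of_periodic_of_tendsto_sub {u v : ℝ → ℝ} {T : ℝ} (hT : 0 < T)
    (hu : Function.Periodic u T) (hv : Function.Periodic v T)
    (h : Tendsto (fun t => u t - v t) atTop (𝓝 0)) : u = v := by
  funext t
  have ht : Tendsto (fun k : ℕ => t + k * T) atTop atTop :=
    tendsto_atTop_add_const_left _ _ (tendsto_natCast_atTop_atTop.atTop_mul_const hT)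
  have hc : (fun s => u s - v s) ∘ (fun k : ℕ => t + k * T) = fun _ => u t - v t := by
    funext k
    simp only [Function.comp_apply, hu.nat_mul k t, hv.nat_mul k t]
  have hconst := h.comp ht
  rw [hc] at hconst
  exact sub_eq_zero.1 (tendsto_nhds_unique tendsto_const_nhds hconst)

/-- Discrete crawler with dry friction whose coefficients `μ_i^±` are
continuous, `T`-periodic and positive, with continuously differentiable `T`-periodic shape
functions `z_i` and a continuous `T`-periodic external load `B` dominated by the friction:
the inclusion `v̇ ∈ G(t,v)` admits exactly one `T`-periodic solution `v*`, which is a global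
attractor for the dynamics. -/
theorem discrete_crawler_dry_smooth (T : ℝ) (hT : 0 < T) (n : ℕ)
    (m : Fin n → ℝ) (hm : ∀ i, 0 ≤ m i) (M : ℝ) (hM : M = ∑ i, m i) (hMpos : 0 < M)
    (μp μm : Fin n → ℝ → ℝ)
    (hμcont : ∀ i, Continuous (μp i) ∧ Continuous (μm i))
    (hμper : ∀ i, Function.Periodic (μp i) T ∧ Function.Periodic (μm i) T)
    (hμpos : ∀ i t, 0 < μp i t ∧ 0 < μm i t)
    (z w : Fin n → ℝ → ℝ)
    (hzper : ∀ i, Function.Periodic (z i) T)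
    (hzderiv : ∀ i t, HasDerivAt (z i) (w i t) t)
    (hwcont : ∀ i, Continuous (w i))
    (B : ℝ → ℝ) (hBcont : Continuous B) (hBper : Function.Periodic B T)
    (hBint : (∫ s in (0:ℝ)..T, (B s - ∑ i, μp i s)) < 0 ∧
      0 < ∫ s in (0:ℝ)..T, (B s + ∑ i, μm i s)) :
    ∃ vstar : ℝ → ℝ,
      (IsSolOn (crawlerG n M B w fun i => dryF (μp i) (μm i)) vstar Set.univ ∧
        Function.Periodic vstar T) ∧
      (∀ u : ℝ → ℝ, IsSolOn (crawlerG n M B w fun i => dryF (μp i) (μm i)) u Set.univ →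
        Function.Periodic u T → u = vstar) ∧
      ∀ (t₀ : ℝ) (v : ℝ → ℝ),
        IsSolOn (crawlerG n M B w fun i => dryF (μp i) (μm i)) v (Set.Ici t₀) →
        Tendsto (fun t => v t - vstar t) atTop (𝓝 0) := by
  have hwper : ∀ i, Function.Periodic (w i) T := fun i t =>
    ((hzderiv i (t + T)).comp_add_const t T).unique ((hzderiv i t).congr_of_eventuallyEq
      (Filter.Eventually.of_forall (hzper i)))
  have hwint : ∀ i, ∫ s in (0 : ℝ)..T, w i s = 0 := fun i => by
    rw [intervalIntegral.integral_eq_sub_of_hasDerivAt (fun t _ => hzderiv i t)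
      ((hwcont i).intervalIntegrable _ _), (hzper i).eq, sub_self]
  obtain ⟨p, hp, hpper⟩ := exists_periodic_crawler_solution hT hMpos hμcont hμper hμpos hwcont
    hwper hBcont hBper hBint.1.le hBint.2.le
  have hattr : ∀ (t₀ : ℝ) (v : ℝ → ℝ),
      IsSolOn (crawlerG n M B w fun i => dryF (μp i) (μm i)) v (Ici t₀) →
      Tendsto (fun t => v t - p t) atTop (𝓝 0) := fun t₀ v hv =>
    crawler_tendsto_sub_zero hT hMpos hμcont hμper hμpos hwcont hwper hwint hBcont hBper
      hBint.1 hBint.2 hpper hp hv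
  exact ⟨p, ⟨hp, hpper⟩, fun u hu huper => eq_of_periodic_of_tendsto_sub hT huper hpper
    (hattr 0 u (hu.mono (subset_univ _))), hattr⟩
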